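/- Assume the generator is human-aligned. Then for every α ∈ (0, 1/2), the portfolio P(α) has coverage strictly greater than (1 − 2α)/k*(α): c(P(α)) > (1 − 2α)/k*(α) > 0. -/

import Mathlib

open Finset

/-- The top-`k` set of a ranking `r` of a finite type `O`: the candidates whose
rank (position under `r`) is among the first `k`. -/
def topk {O : Type*} [Fintype O] [DecidableEq O]
    (r : Fin (Fintype.card O) ≃ O) (k : ℕ) : Finset O :=
  Finset.univ.filter (fun o => ((r.symm o : Fin (Fintype.card O)) : ℕ) < k)

/-- `kstar p r α` is the least `k ≥ 1` such that the probability mass of the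
top-`k` set of the ranking `r` is at least `1 - α`. -/
noncomputable def kstar {O : Type*} [Fintype O] [DecidableEq O]
    (p : O → ℝ) (r : Fin (Fintype.card O) ≃ O) (α : ℝ) : ℕ :=
  sInf {k : ℕ | 1 ≤ k ∧ (1 - α) ≤ ∑ o ∈ topk r k, p o}

theorem sum_topk {O : Type*} [Fintype O] [DecidableEq O]
    (p : O → ℝ) (r : Fin (Fintype.card O) ≃ O) (k : ℕ) :
    ∑ o ∈ topk r k, p o =
      ∑ i ∈ univ.filter (fun i : Fin (Fintype.card O) => (i : ℕ) < k), p (r i) := by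
  simp only [topk, sum_filter]
  rw [← r.sum_comp]
  simp

theorem topk_card {O : Type*} [Fintype O] [DecidableEq O]
    (r : Fin (Fintype.card O) ≃ O) : topk r (Fintype.card O) = univ := by
  simp [topk]

theorem kstar_spec {O : Type*} [Fintype O] [DecidableEq O] [Nonempty O]
    {p : O → ℝ} (hsum : ∑ o, p o = 1) (r : Fin (Fintype.card O) ≃ O) {α : ℝ} (hα : 0 ≤ α) :
    1 ≤ kstar p r α ∧ 1 - α ≤ ∑ o ∈ topk r (kstar p r α), p o := by
  refine Nat.sInf_mem (s := {k : ℕ | 1 ≤ k ∧ 1 - α ≤ ∑ o ∈ topk r k, p o})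
    ⟨Fintype.card O, Fintype.card_pos, ?_⟩
  rw [topk_card, hsum]
  linarith

/-- If the `e`-top-`k` set is disjoint from the `h`-top-`k` set and `p` decreases along `h`,
then the former has at most the mass of the latter. -/
theorem sum_topk_le_of_disjoint {O : Type*} [Fintype O] [DecidableEq O]
    {p : O → ℝ} {e h : Fin (Fintype.card O) ≃ O}
    (halign : ∀ i j : Fin (Fintype.card O), i ≤ j → p (h j) ≤ p (h i))
    {k : ℕ} (hdisj : Disjoint (topk e k) (topk h k)) :
    ∑ o ∈ topk e k, p o ≤ ∑ o ∈ topk h k, p o := by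
  rw [sum_topk, sum_topk]
  refine sum_le_sum fun i hi => ?_
  have hik : (i : ℕ) < k := by simpa using hi
  have hmem : e i ∈ topk e k := by simpa [topk] using hik
  have hrank : k ≤ (h.symm (e i) : ℕ) := by
    simpa [topk] using Finset.disjoint_left.mp hdisj hmem
  simpa using halign i (h.symm (e i)) (Fin.le_def.mpr (hik.le.trans hrank))

/-- If the generator is human-aligned, then for every α ∈ (0, 1/2), the coverage
of the portfolio is strictly greater than (1 - 2α)/k*(α), which is positive. -/
theorem coverage_gt_of_generator_aligned
    (O : Type*) [Fintype O] [DecidableEq O] [Nonempty O]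
    (p : O → ℝ) (hp : ∀ o, 0 ≤ p o) (hsum : ∑ o, p o = 1)
    (e h : Fin (Fintype.card O) ≃ O)
    (halign : ∀ i j : Fin (Fintype.card O), i ≤ j → p (h j) ≤ p (h i))
    (α : ℝ) (hα0 : 0 < α) (hα1 : α < 1/2) :
    (1 - 2 * α) / (kstar p e α : ℝ) <
      ((topk e (kstar p e α) ∩ topk h (kstar p e α)).card : ℝ) / (kstar p e α : ℝ) ∧
    0 < (1 - 2 * α) / (kstar p e α : ℝ) := by
  obtain ⟨hk, hmass⟩ := kstar_spec hsum e hα0.le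
  generalize kstar p e α = k at hk hmass ⊢
  have hk0 : (0 : ℝ) < k := by exact_mod_cast hk
  have hne : (topk e k ∩ topk h k).Nonempty := by
    rw [← not_disjoint_iff_nonempty_inter]
    intro hdisj
    have hle := sum_topk_le_of_disjoint halign hdisj
    have htotal : ∑ o ∈ topk e k ∪ topk h k, p o ≤ ∑ o, p o :=
      sum_le_univ_sum_of_nonneg hp
    rw [sum_union hdisj] at htotal
    linarith
  have hcard : (1 : ℝ) ≤ (topk e k ∩ topk h k).card := by
    exact_mod_cast hne.card_pos
  refine ⟨?_, div_pos (by linarith) hk0⟩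
  gcongr
  linarith
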